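/- Let r ≥ 2 and a ≥ r + 4 be even integers, let G be the Grundy sequence of S({1, a, 2a + r}), and set p = 3a + r. Then there exists N ∈ ℕ such that G(n + p) = G(n) for all n ≥ N, and for 0 ≤ i < p the values G(N + i) are given by: i mod 2 for 0 ≤ i ≤ r + 1; 2 for i = r + 2; (i − r − 3) mod 2 for r + 3 ≤ i ≤ a + r; 2 for i = a + r + 1; (i − a − r − 2) mod 2 for a + r + 2 ≤ i ≤ 2a + r − 1; 2 for i = 2a + r; (i − 2a − r − 1) mod 2 for 2a + r + 1 ≤ i ≤ 2a + 2r + 2; 2 + (i − 2a − 2r − 3) mod 2 for 2a + 2r + 3 ≤ i ≤ 3a + r − 2; and 2 for i = 3a + r − 1. Moreover, for every c ≥ 1, G(n + c) ≠ G(n) holds for all n if and only if: in case r = 2, c ∈ {1, a, 2a + 2}; and in case r ≥ 4, c ∈ {1, a, 2a + r, 2a + r + 2, 3a + r + 1, 5a + 2r + 2}. -/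

import Mathlib

/-- The minimum excludant: the least natural number not in `X`. -/
noncomputable def mex (X : Set ℕ) : ℕ := sInf {m | m ∉ X}

/-- `G` is the Grundy (nim-value) sequence of the subtraction game with
subtraction set `S`: `G n = mex { G (n - s) : s ∈ S, s ≤ n }`. -/
def IsGrundy (S : Finset ℕ) (G : ℕ → ℕ) : Prop :=
  ∀ n, G n = mex {v | ∃ s ∈ S, s ≤ n ∧ v = G (n - s)}

namespace IsGrundy

variable {S : Finset ℕ} {G : ℕ → ℕ}

theorem notMem_options (hG : IsGrundy S G) (n : ℕ) :
    G n ∉ {v | ∃ s ∈ S, s ≤ n ∧ v = G (n - s)} := by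
  have hfin : {v | ∃ s ∈ S, s ≤ n ∧ v = G (n - s)}.Finite := by
    refine (S.finite_toSet.image fun s => G (n - s)).subset ?_
    rintro v ⟨s, hs, -, rfl⟩
    exact ⟨s, hs, rfl⟩
  have h : sInf {m | m ∉ {v | ∃ s ∈ S, s ≤ n ∧ v = G (n - s)}} ∈ _ :=
    Nat.sInf_mem hfin.infinite_compl.nonempty
  rw [hG n]
  exact h

theorem mem_options_of_lt (hG : IsGrundy S G) {m n : ℕ} (hm : m < G n) :
    m ∈ {v | ∃ s ∈ S, s ≤ n ∧ v = G (n - s)} := by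
  by_contra h
  rw [hG n] at hm
  exact Nat.notMem_of_lt_sInf hm h

/-- Elements of the subtraction set are safe additions. -/
theorem add_ne (hG : IsGrundy S G) {s : ℕ} (hs : s ∈ S) (n : ℕ) : G (n + s) ≠ G n := fun h =>
  hG.notMem_options (n + s) ⟨s, hs, by omega, by simpa using h⟩

end IsGrundy

variable {a b : ℕ} {G : ℕ → ℕ}

theorem IsGrundy.eq_of_options (hG : IsGrundy {1, a, b} G) {n v : ℕ}
    (h1 : 1 ≤ n → G (n - 1) ≠ v) (ha : a ≤ n → G (n - a) ≠ v) (hb : b ≤ n → G (n - b) ≠ v)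
    (hlt : ∀ m < v,
      1 ≤ n ∧ G (n - 1) = m ∨ a ≤ n ∧ G (n - a) = m ∨ b ≤ n ∧ G (n - b) = m) : G n = v := by
  rcases lt_trichotomy (G n) v with h | h | h
  · rcases hlt _ h with ⟨hn, h⟩ | ⟨hn, h⟩ | ⟨hn, h⟩
    · exact absurd ⟨1, by simp, hn, h.symm⟩ (hG.notMem_options n)
    · exact absurd ⟨a, by simp, hn, h.symm⟩ (hG.notMem_options n)
    · exact absurd ⟨b, by simp, hn, h.symm⟩ (hG.notMem_options n)
  · exact h
  · obtain ⟨s, hs, hsn, rfl⟩ := hG.mem_options_of_lt h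
    simp only [Finset.mem_insert, Finset.mem_singleton] at hs
    rcases hs with rfl | rfl | rfl
    · exact absurd rfl (h1 hsn)
    · exact absurd rfl (ha hsn)
    · exact absurd rfl (hb hsn)

theorem run_induction {P : ℕ → Prop} {s e : ℕ}
    (h : ∀ n, s ≤ n → n < e → (s < n → P (n - 1)) → P n) : ∀ n, s ≤ n → n < e → P n := by
  intro n hs
  induction n, hs using Nat.le_induction with
  | base => exact fun he => h s le_rfl he fun hlt => absurd hlt (lt_irrefl s)
  | succ k hk ih => exact fun he => h (k + 1) (by omega) he fun _ => ih (by omega)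

/-- A run of the alternating values `0, 1, 0, 1, …`. -/
theorem IsGrundy.run_zero_one (hG : IsGrundy {1, a, b} G) {s e c : ℕ} (hc : (s + c) % 2 = 0)
    (hs : 1 ≤ s → G (s - 1) ≠ 0) (ha : ∀ n, s ≤ n → n < e → a ≤ n → G (n - a) ≠ (n + c) % 2)
    (hb : ∀ n, s ≤ n → n < e → b ≤ n → G (n - b) ≠ (n + c) % 2) :
    ∀ n, s ≤ n → n < e → G n = (n + c) % 2 := by
  refine run_induction fun n hsn hne ih => ?_
  rcases hsn.eq_or_lt with rfl | hlt
  · exact hG.eq_of_options (by rwa [hc]) (ha _ le_rfl hne) (hb _ le_rfl hne) (by omega)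
  · have h := ih hlt
    exact hG.eq_of_options (by omega) (ha n hsn hne) (hb n hsn hne) (by omega)

/-- A run of alternating values `2` and `3`. -/
theorem IsGrundy.run_two_three (hG : IsGrundy {1, a, b} G) {s e c : ℕ} (has : a ≤ s) (hbs : b ≤ s)
    (h1 : 1 ≤ s)
    (hs : (s + c) % 2 = 0 ∧ G (s - 1) ≠ 2 ∨ (s + c) % 2 = 1 ∧ G (s - 1) = 2)
    (h : ∀ n, s ≤ n → n < e → G (n - a) + G (n - b) = 1) :
    ∀ n, s ≤ n → n < e → G n = 2 + (n + c) % 2 := by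
  refine run_induction fun n hsn hne ih => ?_
  have hsum := h n hsn hne
  have hprev : (n + c) % 2 = 0 ∧ G (n - 1) ≠ 2 ∨ (n + c) % 2 = 1 ∧ G (n - 1) = 2 := by
    rcases hsn.eq_or_lt with rfl | hlt
    · exact hs
    · have := ih hlt
      omega
  exact hG.eq_of_options (by omega) (by omega) (by omega) (by omega)

theorem IsGrundy.eq_two (hG : IsGrundy {1, a, b} G) {n : ℕ} (hn : 1 ≤ n) (h1 : G (n - 1) = 1)
    (ha : a ≤ n → G (n - a) ≠ 2) (hb : b ≤ n → G (n - b) ≠ 2)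
    (h0 : a ≤ n ∧ G (n - a) = 0 ∨ b ≤ n ∧ G (n - b) = 0) : G n = 2 :=
  hG.eq_of_options (by omega) ha hb (by omega)

/-- The values of `G` on `[0, 6 * a + r + 1)`. Here `t` is `1` if `r = 2` and `0` if `4 ≤ r`. -/
structure PreperiodRuns (G : ℕ → ℕ) (a r t : ℕ) : Prop where
  run0 : ∀ n, n < a → G n = n % 2
  run1 : ∀ n, n = a → G n = 2
  run2 : ∀ n, a + 1 ≤ n → n < 2 * a + 1 → G n = (n + 1) % 2
  run3 : ∀ n, n = 2 * a + 1 → G n = 2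
  run4 : ∀ n, 2 * a + 2 ≤ n → n < 2 * a + r → G n = n % 2
  run5 : ∀ n, 2 * a + r ≤ n → n < 3 * a + 1 → G n = 2 + (n + t) % 2
  run6 : ∀ n, 3 * a + 1 ≤ n → n < 3 * a + r + 1 → G n = (n + 1) % 2
  run7 : ∀ n, n = 3 * a + r + 1 → G n = 2 + t
  run8 : ∀ n, 3 * a + r + 2 ≤ n → n < 4 * a + r + 2 → G n = n % 2
  run9 : ∀ n, n = 4 * a + r + 2 → G n = 2
  run10 : ∀ n, 4 * a + r + 3 ≤ n → n < 5 * a + r + 1 → G n = (n + 1) % 2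
  run11 : ∀ n, n = 5 * a + r + 1 → G n = 2
  run12 : ∀ n, 5 * a + r + 2 ≤ n → n < 5 * a + 2 * r + 2 → G n = n % 2
  run13 : ∀ n, 5 * a + 2 * r + 2 ≤ n → n < 6 * a + r + 1 → G n = 2 + n % 2

/-- The values of `G` on a period `[M, M + 3 * a + r)`, for odd `M`. -/
structure PeriodRuns (G : ℕ → ℕ) (a r M : ℕ) : Prop where
  run0 : ∀ n, M ≤ n → n < M + r + 2 → G n = (n + 1) % 2
  run1 : ∀ n, n = M + r + 2 → G n = 2
  run2 : ∀ n, M + r + 3 ≤ n → n < M + a + r + 1 → G n = n % 2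
  run3 : ∀ n, n = M + a + r + 1 → G n = 2
  run4 : ∀ n, M + a + r + 2 ≤ n → n < M + 2 * a + r → G n = (n + 1) % 2
  run5 : ∀ n, n = M + 2 * a + r → G n = 2
  run6 : ∀ n, M + 2 * a + r + 1 ≤ n → n < M + 2 * a + 2 * r + 3 → G n = n % 2
  run7 : ∀ n, M + 2 * a + 2 * r + 3 ≤ n → n < M + 3 * a + r → G n = 2 + n % 2

variable {r t M : ℕ}

theorem IsGrundy.preperiodRuns (hG : IsGrundy {1, a, 2 * a + r} G)
    (hr : 2 ≤ r) (hr2 : r % 2 = 0) (ha : r + 4 ≤ a) (ha2 : a % 2 = 0)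
    (ht : r = 2 ∧ t = 1 ∨ 4 ≤ r ∧ t = 0) : PreperiodRuns G a r t := by
  have h0 : ∀ n, n < a → G n = n % 2 := by
    intro n hn
    exact hG.run_zero_one (s := 0) (e := a) (c := 0) rfl (by omega) (by omega) (by omega)
      n n.zero_le hn
  have h1 : ∀ n, n = a → G n = 2 := by
    intro n hn
    refine hG.eq_two (by omega) ?_ (fun _ => ?_) (fun _ => ?_) ?_
    · have := h0 (n - 1)
      omega
    · have := h0 (n - a)
      omega
    · omega
    · have := h0 (n - a)
      omega
  have h2 : ∀ n, a + 1 ≤ n → n < 2 * a + 1 → G n = (n + 1) % 2 := by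
    refine hG.run_zero_one (by omega) (fun _ => ?_) (fun n hn hn' _ => ?_)
      fun n hn hn' _ => ?_
    · have := h1 (a + 1 - 1)
      omega
    · have := h0 (n - a)
      have := h1 (n - a)
      omega
    · omega
  have h3 : ∀ n, n = 2 * a + 1 → G n = 2 := by
    intro n hn
    refine hG.eq_two (by omega) ?_ (fun _ => ?_) (fun _ => ?_) ?_
    · have := h2 (n - 1)
      omega
    · have := h2 (n - a)
      omega
    · omega
    · have := h2 (n - a)
      omega
  have h4 : ∀ n, 2 * a + 2 ≤ n → n < 2 * a + r → G n = n % 2 := by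
    refine hG.run_zero_one (c := 0) (by omega) (fun _ => ?_) (fun n hn hn' _ => ?_)
      fun n hn hn' _ => ?_
    · have := h3 (2 * a + 2 - 1)
      omega
    · have := h2 (n - a)
      omega
    · omega
  have h5 : ∀ n, 2 * a + r ≤ n → n < 3 * a + 1 → G n = 2 + (n + t) % 2 := by
    refine hG.run_two_three (by omega) (by omega) (by omega) ?_ fun n hn hn' => ?_
    · have := h3 (2 * a + r - 1)
      have := h4 (2 * a + r - 1)
      omega
    · have := h2 (n - a)
      have := h0 (n - (2 * a + r))
      omega
  have h6 : ∀ n, 3 * a + 1 ≤ n → n < 3 * a + r + 1 → G n = (n + 1) % 2 := by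
    refine hG.run_zero_one (by omega) (fun _ => ?_) (fun n hn hn' _ => ?_)
      fun n hn hn' _ => ?_
    · have := h5 (3 * a + 1 - 1)
      omega
    · have := h3 (n - a)
      have := h4 (n - a)
      have := h5 (n - a)
      omega
    · have := h0 (n - (2 * a + r))
      have := h1 (n - (2 * a + r))
      omega
  have h7 : ∀ n, n = 3 * a + r + 1 → G n = 2 + t := by
    intro n hn
    have := h6 (n - 1)
    have := h5 (n - a)
    have := h2 (n - (2 * a + r))
    exact hG.eq_of_options (by omega) (by omega) (by omega) (by omega)
  have h8 : ∀ n, 3 * a + r + 2 ≤ n → n < 4 * a + r + 2 → G n = n % 2 := by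
    refine hG.run_zero_one (c := 0) (by omega) (fun _ => ?_) (fun n hn hn' _ => ?_)
      fun n hn hn' _ => ?_
    · have := h7 (3 * a + r + 2 - 1)
      omega
    · have := h5 (n - a)
      have := h6 (n - a)
      have := h7 (n - a)
      omega
    · have := h2 (n - (2 * a + r))
      have := h3 (n - (2 * a + r))
      omega
  have h9 : ∀ n, n = 4 * a + r + 2 → G n = 2 := by
    intro n hn
    refine hG.eq_two (by omega) ?_ (fun _ => ?_) (fun _ => ?_) ?_
    · have := h8 (n - 1)
      omega
    · have := h8 (n - a)
      omega
    · have := h4 (n - (2 * a + r))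
      have := h5 (n - (2 * a + r))
      omega
    · have := h8 (n - a)
      have := h4 (n - (2 * a + r))
      have := h5 (n - (2 * a + r))
      omega
  have h10 : ∀ n, 4 * a + r + 3 ≤ n → n < 5 * a + r + 1 → G n = (n + 1) % 2 := by
    refine hG.run_zero_one (by omega) (fun _ => ?_) (fun n hn hn' _ => ?_)
      fun n hn hn' _ => ?_
    · have := h9 (4 * a + r + 3 - 1)
      omega
    · have := h8 (n - a)
      omega
    · have := h4 (n - (2 * a + r))
      have := h5 (n - (2 * a + r))
      omega
  have h11 : ∀ n, n = 5 * a + r + 1 → G n = 2 := by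
    intro n hn
    refine hG.eq_two (by omega) ?_ (fun _ => ?_) (fun _ => ?_) ?_
    · have := h10 (n - 1)
      omega
    · have := h8 (n - a)
      omega
    · have := h6 (n - (2 * a + r))
      omega
    · have := h8 (n - a)
      have := h6 (n - (2 * a + r))
      omega
  have h12 : ∀ n, 5 * a + r + 2 ≤ n → n < 5 * a + 2 * r + 2 → G n = n % 2 := by
    refine hG.run_zero_one (c := 0) (by omega) (fun _ => ?_) (fun n hn hn' _ => ?_)
      fun n hn hn' _ => ?_
    · have := h11 (5 * a + r + 2 - 1)
      omega
    · have := h9 (n - a)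
      have := h10 (n - a)
      omega
    · have := h6 (n - (2 * a + r))
      have := h7 (n - (2 * a + r))
      omega
  have h13 : ∀ n, 5 * a + 2 * r + 2 ≤ n → n < 6 * a + r + 1 → G n = 2 + n % 2 := by
    refine hG.run_two_three (c := 0) (by omega) (by omega) (by omega) ?_ fun n hn hn' => ?_
    · have := h12 (5 * a + 2 * r + 2 - 1)
      omega
    · have := h10 (n - a)
      have := h8 (n - (2 * a + r))
      omega
  exact ⟨h0, h1, h2, h3, h4, h5, h6, h7, h8, h9, h10, h11, h12, h13⟩

/-- A window of length `2 * a + r` determines the following period. The point `e` where its last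
run starts takes one of two values, according to whether the window is preperiodic or periodic. -/
theorem IsGrundy.periodRuns_of_window {b e : ℕ} (hG : IsGrundy {1, a, 2 * a + r} G)
    (hr : 2 ≤ r) (hr2 : r % 2 = 0) (ha : r + 4 ≤ a) (ha2 : a % 2 = 0)
    (hb : b % 2 = 1) (he : e = b + a + 2 * r + 1 ∨ e = b + a + 2 * r + 3)
    (w0 : ∀ n, b ≤ n → n < b + r + 1 → G n = n % 2)
    (w1 : ∀ n, n = b + r + 1 → G n = 2)
    (w2 : ∀ n, b + r + 2 ≤ n → n < b + a + r → G n = (n + 1) % 2)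
    (w3 : ∀ n, n = b + a + r → G n = 2)
    (w4 : ∀ n, b + a + r + 1 ≤ n → n < e → G n = n % 2)
    (w5 : ∀ n, e ≤ n → n < b + 2 * a + r → G n = 2 + n % 2) :
    PeriodRuns G a r (b + 2 * a + r) := by
  have h0 : ∀ n, b + 2 * a + r ≤ n → n < b + 2 * a + 2 * r + 2 → G n = (n + 1) % 2 := by
    refine hG.run_zero_one (by omega) (fun _ => ?_) (fun n hn hn' _ => ?_)
      fun n hn hn' _ => ?_
    · have := w5 (b + 2 * a + r - 1)
      omega
    · have := w3 (n - a)
      have := w4 (n - a)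
      have := w5 (n - a)
      omega
    · have := w0 (n - (2 * a + r))
      have := w1 (n - (2 * a + r))
      omega
  have h1 : ∀ n, n = b + 2 * a + 2 * r + 2 → G n = 2 := by
    intro n hn
    refine hG.eq_two (by omega) ?_ (fun _ => ?_) (fun _ => ?_) ?_
    · have := h0 (n - 1)
      omega
    · have := w4 (n - a)
      have := w5 (n - a)
      omega
    · have := w2 (n - (2 * a + r))
      omega
    · have := w4 (n - a)
      have := w5 (n - a)
      have := w2 (n - (2 * a + r))
      omega
  have h2 : ∀ n, b + 2 * a + 2 * r + 3 ≤ n → n < b + 3 * a + 2 * r + 1 → G n = n % 2 := by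
    refine hG.run_zero_one (c := 0) (by omega) (fun _ => ?_) (fun n hn hn' _ => ?_)
      fun n hn hn' _ => ?_
    · have := h1 (b + 2 * a + 2 * r + 3 - 1)
      omega
    · have := w5 (n - a)
      have := h0 (n - a)
      omega
    · have := w2 (n - (2 * a + r))
      have := w3 (n - (2 * a + r))
      omega
  have h3 : ∀ n, n = b + 3 * a + 2 * r + 1 → G n = 2 := by
    intro n hn
    refine hG.eq_two (by omega) ?_ (fun _ => ?_) (fun _ => ?_) ?_
    · have := h2 (n - 1)
      omega
    · have := h0 (n - a)
      omega
    · have := w4 (n - (2 * a + r))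
      omega
    · have := h0 (n - a)
      have := w4 (n - (2 * a + r))
      omega
  have h4 : ∀ n, b + 3 * a + 2 * r + 2 ≤ n → n < b + 4 * a + 2 * r → G n = (n + 1) % 2 := by
    refine hG.run_zero_one (by omega) (fun _ => ?_) (fun n hn hn' _ => ?_)
      fun n hn hn' _ => ?_
    · have := h3 (b + 3 * a + 2 * r + 2 - 1)
      omega
    · have := h1 (n - a)
      have := h2 (n - a)
      omega
    · have := w4 (n - (2 * a + r))
      have := w5 (n - (2 * a + r))
      omega
  have h5 : ∀ n, n = b + 4 * a + 2 * r → G n = 2 := by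
    intro n hn
    refine hG.eq_two (by omega) ?_ (fun _ => ?_) (fun _ => ?_) ?_
    · have := h4 (n - 1)
      omega
    · have := h2 (n - a)
      omega
    · have := h0 (n - (2 * a + r))
      omega
    · have := h2 (n - a)
      have := h0 (n - (2 * a + r))
      omega
  have h6 : ∀ n, b + 4 * a + 2 * r + 1 ≤ n → n < b + 4 * a + 3 * r + 3 → G n = n % 2 := by
    refine hG.run_zero_one (c := 0) (by omega) (fun _ => ?_) (fun n hn hn' _ => ?_)
      fun n hn hn' _ => ?_
    · have := h5 (b + 4 * a + 2 * r + 1 - 1)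
      omega
    · have := h3 (n - a)
      have := h4 (n - a)
      omega
    · have := h0 (n - (2 * a + r))
      have := h1 (n - (2 * a + r))
      omega
  have h7 : ∀ n, b + 4 * a + 3 * r + 3 ≤ n → n < b + 5 * a + 2 * r → G n = 2 + n % 2 := by
    refine hG.run_two_three (c := 0) (by omega) (by omega) (by omega) ?_ fun n hn hn' => ?_
    · have := h6 (b + 4 * a + 3 * r + 3 - 1)
      omega
    · have := h4 (n - a)
      have := h2 (n - (2 * a + r))
      omega
  constructor
  · exact fun n hn hn' => h0 n (by omega) (by omega)
  · exact fun n hn => h1 n (by omega)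
  · exact fun n hn hn' => h2 n (by omega) (by omega)
  · exact fun n hn => h3 n (by omega)
  · exact fun n hn hn' => h4 n (by omega) (by omega)
  · exact fun n hn => h5 n (by omega)
  · exact fun n hn hn' => h6 n (by omega) (by omega)
  · exact fun n hn hn' => h7 n (by omega) (by omega)

theorem IsGrundy.periodRuns_preperiod (hG : IsGrundy {1, a, 2 * a + r} G)
    (hr : 2 ≤ r) (hr2 : r % 2 = 0) (ha : r + 4 ≤ a) (ha2 : a % 2 = 0)
    (h : PreperiodRuns G a r t) : PeriodRuns G a r (6 * a + r + 1) := by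
  rw [show 6 * a + r + 1 = (4 * a + 1) + 2 * a + r by ring]
  exact hG.periodRuns_of_window (e := 5 * a + 2 * r + 2) hr hr2 ha ha2 (by omega) (by omega)
    (fun n _ _ => h.run8 n (by omega) (by omega)) (fun n _ => h.run9 n (by omega))
    (fun n _ _ => h.run10 n (by omega) (by omega)) (fun n _ => h.run11 n (by omega))
    (fun n _ _ => h.run12 n (by omega) (by omega)) (fun n _ _ => h.run13 n (by omega) (by omega))

theorem PeriodRuns.next (h : PeriodRuns G a r M) (hG : IsGrundy {1, a, 2 * a + r} G)
    (hr : 2 ≤ r) (hr2 : r % 2 = 0) (ha : r + 4 ≤ a) (ha2 : a % 2 = 0)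
    (hM : M % 2 = 1) : PeriodRuns G a r (M + (3 * a + r)) := by
  rw [show M + (3 * a + r) = (M + a) + 2 * a + r by ring]
  exact hG.periodRuns_of_window (e := M + 2 * a + 2 * r + 3) hr hr2 ha ha2 (by omega) (by omega)
    (fun n _ _ => h.run2 n (by omega) (by omega)) (fun n _ => h.run3 n (by omega))
    (fun n _ _ => h.run4 n (by omega) (by omega)) (fun n _ => h.run5 n (by omega))
    (fun n _ _ => h.run6 n (by omega) (by omega)) (fun n _ _ => h.run7 n (by omega) (by omega))

theorem IsGrundy.periodRuns_add_mul (hG : IsGrundy {1, a, 2 * a + r} G)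
    (hr : 2 ≤ r) (hr2 : r % 2 = 0) (ha : r + 4 ≤ a) (ha2 : a % 2 = 0)
    (h : PreperiodRuns G a r t) (k : ℕ) :
    PeriodRuns G a r (6 * a + r + 1 + k * (3 * a + r)) := by
  induction k with
  | zero => simpa using hG.periodRuns_preperiod hr hr2 ha ha2 h
  | succ k ih =>
    have hk : (k * (3 * a + r)) % 2 = 0 := by
      rw [Nat.mul_mod, show (3 * a + r) % 2 = 0 by omega, Nat.mul_zero, Nat.zero_mod]
    rw [Nat.succ_mul k, ← Nat.add_assoc]
    exact ih.next hG hr hr2 ha ha2 (by omega)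

theorem PeriodRuns.add_period_eq (h : PeriodRuns G a r M) (h' : PeriodRuns G a r (M + (3 * a + r)))
    (hr2 : r % 2 = 0) (ha2 : a % 2 = 0) {n : ℕ} (hn : M ≤ n) (hn' : n < M + 3 * a + r) :
    G (n + (3 * a + r)) = G n := by
  rcases lt_or_ge n (M + r + 2) with hlt | hge0
  · rw [h.run0 n (by omega) (by omega), h'.run0 (n + (3 * a + r)) (by omega) (by omega)]; omega
  rcases lt_or_ge n (M + r + 3) with hlt | hge1
  · rw [h.run1 n (by omega), h'.run1 (n + (3 * a + r)) (by omega)]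
  rcases lt_or_ge n (M + a + r + 1) with hlt | hge2
  · rw [h.run2 n (by omega) (by omega), h'.run2 (n + (3 * a + r)) (by omega) (by omega)]; omega
  rcases lt_or_ge n (M + a + r + 2) with hlt | hge3
  · rw [h.run3 n (by omega), h'.run3 (n + (3 * a + r)) (by omega)]
  rcases lt_or_ge n (M + 2 * a + r) with hlt | hge4
  · rw [h.run4 n (by omega) (by omega), h'.run4 (n + (3 * a + r)) (by omega) (by omega)]; omega
  rcases lt_or_ge n (M + 2 * a + r + 1) with hlt | hge5
  · rw [h.run5 n (by omega), h'.run5 (n + (3 * a + r)) (by omega)]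
  rcases lt_or_ge n (M + 2 * a + 2 * r + 3) with hlt | hge6
  · rw [h.run6 n (by omega) (by omega), h'.run6 (n + (3 * a + r)) (by omega) (by omega)]; omega
  rw [h.run7 n (by omega) (by omega), h'.run7 (n + (3 * a + r)) (by omega) (by omega)]; omega

theorem IsGrundy.add_period_eq (hG : IsGrundy {1, a, 2 * a + r} G)
    (hr : 2 ≤ r) (hr2 : r % 2 = 0) (ha : r + 4 ≤ a) (ha2 : a % 2 = 0)
    (h : PreperiodRuns G a r t) {n : ℕ} (hn : 6 * a + r + 1 ≤ n) :
    G (n + (3 * a + r)) = G n := by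
  have hdiv := Nat.div_add_mod' (n - (6 * a + r + 1)) (3 * a + r)
  have hlt := Nat.mod_lt (n - (6 * a + r + 1)) (show 0 < 3 * a + r by omega)
  set k := (n - (6 * a + r + 1)) / (3 * a + r)
  have h0 := hG.periodRuns_add_mul hr hr2 ha ha2 h k
  have h1 := hG.periodRuns_add_mul hr hr2 ha ha2 h (k + 1)
  rw [Nat.succ_mul k, ← Nat.add_assoc] at h1
  exact h0.add_period_eq h1 hr2 ha2 (by omega) (by omega)

theorem PreperiodRuns.add_two_mul_add_two_ne (h : PreperiodRuns G a r 0)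
    (p : ∀ k, PeriodRuns G a r (6 * a + r + 1 + k * (3 * a + r)))
    (hr : 4 ≤ r) (hr2 : r % 2 = 0) (ha : r + 4 ≤ a) (ha2 : a % 2 = 0)
    {n : ℕ} (hn : n < 6 * a + r + 1 + (3 * a + r)) : G (n + (2 * a + r + 2)) ≠ G n := by
  obtain ⟨m, hm⟩ : ∃ m, m = n + (2 * a + r + 2) := ⟨_, rfl⟩
  rw [← hm]
  rcases lt_or_ge n a with hlt | hge
  · have := h.run0 n
    have := h.run5 m
    have := h.run6 m
    have := h.run7 m
    omega
  rcases lt_or_ge n (a + 1) with hlt | hge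
  · have := h.run1 n
    have := h.run8 m
    omega
  rcases lt_or_ge n (2 * a + 1) with hlt | hge
  · have := h.run2 n
    have := h.run8 m
    have := h.run9 m
    omega
  rcases lt_or_ge n (2 * a + 2) with hlt | hge
  · have := h.run3 n
    have := h.run10 m
    omega
  rcases lt_or_ge n (2 * a + r) with hlt | hge
  · have := h.run4 n
    have := h.run10 m
    omega
  rcases lt_or_ge n (3 * a + 1) with hlt | hge
  · have := h.run5 n
    have := h.run10 m
    have := h.run11 m
    have := h.run12 m
    omega
  rcases lt_or_ge n (3 * a + r + 1) with hlt | hge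
  · have := h.run6 n
    have := h.run12 m
    have := h.run13 m
    omega
  rcases lt_or_ge n (3 * a + r + 2) with hlt | hge
  · have := h.run7 n
    have := h.run13 m
    omega
  rcases lt_or_ge n (4 * a + r + 2) with hlt | hge
  · have := h.run8 n
    have := h.run13 m
    have := (p 0).run0 m
    have := (p 0).run1 m
    omega
  rcases lt_or_ge n (4 * a + r + 3) with hlt | hge
  · have := h.run9 n
    have := (p 0).run2 m
    omega
  rcases lt_or_ge n (5 * a + r + 1) with hlt | hge
  · have := h.run10 n
    have := (p 0).run2 m
    have := (p 0).run3 m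
    omega
  rcases lt_or_ge n (5 * a + r + 2) with hlt | hge
  · have := h.run11 n
    have := (p 0).run4 m
    omega
  rcases lt_or_ge n (5 * a + 2 * r + 2) with hlt | hge
  · have := h.run12 n
    have := (p 0).run4 m
    omega
  rcases lt_or_ge n (6 * a + r + 1) with hlt | hge
  · have := h.run13 n
    have := (p 0).run4 m
    have := (p 0).run5 m
    have := (p 0).run6 m
    omega
  rcases lt_or_ge n (6 * a + 2 * r + 3) with hlt | hge
  · have := (p 0).run0 n
    have := (p 0).run6 m
    have := (p 0).run7 m
    omega
  rcases lt_or_ge n (6 * a + 2 * r + 4) with hlt | hge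
  · have := (p 0).run1 n
    have := (p 0).run7 m
    have := (p 1).run0 m
    omega
  rcases lt_or_ge n (7 * a + 2 * r + 2) with hlt | hge
  · have := (p 0).run2 n
    have := (p 0).run7 m
    have := (p 1).run0 m
    have := (p 1).run1 m
    omega
  rcases lt_or_ge n (7 * a + 2 * r + 3) with hlt | hge
  · have := (p 0).run3 n
    have := (p 1).run2 m
    omega
  rcases lt_or_ge n (8 * a + 2 * r + 1) with hlt | hge
  · have := (p 0).run4 n
    have := (p 1).run2 m
    have := (p 1).run3 m
    omega
  rcases lt_or_ge n (8 * a + 2 * r + 2) with hlt | hge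
  · have := (p 0).run5 n
    have := (p 1).run4 m
    omega
  rcases lt_or_ge n (8 * a + 3 * r + 4) with hlt | hge
  · have := (p 0).run6 n
    have := (p 1).run4 m
    have := (p 1).run5 m
    omega
  have := (p 0).run7 n
  have := (p 1).run4 m
  have := (p 1).run5 m
  have := (p 1).run6 m
  omega

theorem PreperiodRuns.add_period_add_one_ne (h : PreperiodRuns G a r 0)
    (p : ∀ k, PeriodRuns G a r (6 * a + r + 1 + k * (3 * a + r)))
    (hr : 4 ≤ r) (hr2 : r % 2 = 0) (ha : r + 4 ≤ a) (ha2 : a % 2 = 0)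
    {n : ℕ} (hn : n < 6 * a + r + 1) : G (n + (3 * a + r + 1)) ≠ G n := by
  obtain ⟨m, hm⟩ : ∃ m, m = n + (3 * a + r + 1) := ⟨_, rfl⟩
  rw [← hm]
  rcases lt_or_ge n a with hlt | hge
  · have := h.run0 n
    have := h.run7 m
    have := h.run8 m
    omega
  rcases lt_or_ge n (a + 1) with hlt | hge
  · have := h.run1 n
    have := h.run8 m
    omega
  rcases lt_or_ge n (2 * a + 1) with hlt | hge
  · have := h.run2 n
    have := h.run9 m
    have := h.run10 m
    have := h.run11 m
    omega
  rcases lt_or_ge n (2 * a + 2) with hlt | hge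
  · have := h.run3 n
    have := h.run12 m
    omega
  rcases lt_or_ge n (2 * a + r) with hlt | hge
  · have := h.run4 n
    have := h.run12 m
    omega
  rcases lt_or_ge n (3 * a + 1) with hlt | hge
  · have := h.run5 n
    have := h.run12 m
    have := h.run13 m
    have := (p 0).run0 m
    omega
  rcases lt_or_ge n (3 * a + r + 1) with hlt | hge
  · have := h.run6 n
    have := (p 0).run0 m
    omega
  rcases lt_or_ge n (3 * a + r + 2) with hlt | hge
  · have := h.run7 n
    have := (p 0).run0 m
    omega
  rcases lt_or_ge n (4 * a + r + 2) with hlt | hge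
  · have := h.run8 n
    have := (p 0).run1 m
    have := (p 0).run2 m
    have := (p 0).run3 m
    omega
  rcases lt_or_ge n (4 * a + r + 3) with hlt | hge
  · have := h.run9 n
    have := (p 0).run4 m
    omega
  rcases lt_or_ge n (5 * a + r + 1) with hlt | hge
  · have := h.run10 n
    have := (p 0).run4 m
    have := (p 0).run5 m
    omega
  rcases lt_or_ge n (5 * a + r + 2) with hlt | hge
  · have := h.run11 n
    have := (p 0).run6 m
    omega
  rcases lt_or_ge n (5 * a + 2 * r + 2) with hlt | hge
  · have := h.run12 n
    have := (p 0).run6 m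
    omega
  have := h.run13 n
  have := (p 0).run6 m
  have := (p 0).run7 m
  have := (p 1).run0 m
  omega

theorem PreperiodRuns.add_period_add_two_mul_add_two_ne (h : PreperiodRuns G a r 0)
    (p : ∀ k, PeriodRuns G a r (6 * a + r + 1 + k * (3 * a + r)))
    (hr : 4 ≤ r) (hr2 : r % 2 = 0) (ha : r + 4 ≤ a) (ha2 : a % 2 = 0)
    {n : ℕ} (hn : n < 4 * a) : G (n + (5 * a + 2 * r + 2)) ≠ G n := by
  obtain ⟨m, hm⟩ : ∃ m, m = n + (5 * a + 2 * r + 2) := ⟨_, rfl⟩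
  rw [← hm]
  rcases lt_or_ge n a with hlt | hge
  · have := h.run0 n
    have := h.run13 m
    have := (p 0).run0 m
    omega
  rcases lt_or_ge n (a + 1) with hlt | hge
  · have := h.run1 n
    have := (p 0).run0 m
    omega
  rcases lt_or_ge n (2 * a + 1) with hlt | hge
  · have := h.run2 n
    have := (p 0).run1 m
    have := (p 0).run2 m
    have := (p 0).run3 m
    omega
  rcases lt_or_ge n (2 * a + 2) with hlt | hge
  · have := h.run3 n
    have := (p 0).run4 m
    omega
  rcases lt_or_ge n (2 * a + r) with hlt | hge
  · have := h.run4 n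
    have := (p 0).run4 m
    omega
  rcases lt_or_ge n (3 * a + 1) with hlt | hge
  · have := h.run5 n
    have := (p 0).run4 m
    have := (p 0).run5 m
    have := (p 0).run6 m
    omega
  rcases lt_or_ge n (3 * a + r + 1) with hlt | hge
  · have := h.run6 n
    have := (p 0).run6 m
    omega
  rcases lt_or_ge n (3 * a + r + 2) with hlt | hge
  · have := h.run7 n
    have := (p 0).run6 m
    omega
  have := h.run8 n
  have := (p 0).run7 m
  have := (p 1).run0 m
  omega

theorem PreperiodRuns.eq_of_add_ne (h : PreperiodRuns G a r 0)
    (p : ∀ k, PeriodRuns G a r (6 * a + r + 1 + k * (3 * a + r)))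
    (hr : 4 ≤ r) (hr2 : r % 2 = 0) (ha : r + 4 ≤ a) (ha2 : a % 2 = 0)
    {c : ℕ} (hc1 : 1 ≤ c) (hcN : c < 6 * a + r + 1 + (3 * a + r)) (hc : ∀ n, G (n + c) ≠ G n) :
    c = 1 ∨ c = a ∨ c = 2 * a + r ∨ c = 2 * a + r + 2 ∨ c = 3 * a + r + 1 ∨
      c = 5 * a + 2 * r + 2 := by
  by_contra! hne
  rcases Nat.mod_two_eq_zero_or_one c with hpar | hpar
  · have b1 : a ≤ c := by
      have := hc 0
      have := h.run0 (0 + c)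
      have := h.run0 0
      omega
    have b2 : 2 * a ≤ c := by
      have := hc (6 * a + 2 * r + 1)
      have := (p 0).run4 (6 * a + 2 * r + 1 + c)
      have := (p 0).run0 (6 * a + 2 * r + 1)
      omega
    have b3 : 2 * a + r ≤ c := by
      have := hc (a + 1)
      have := h.run6 (a + 1 + c)
      have := h.run2 (a + 1)
      omega
    have b4 : 3 * a + r + 4 ≤ c := by
      have := hc (a - 1)
      have := h.run8 (a - 1 + c)
      have := h.run0 (a - 1)
      omega
    have b5 : 4 * a + r + 2 ≤ c := by
      have := hc 0
      have := h.run8 (0 + c)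
      have := h.run0 0
      omega
    have b6 : 5 * a + r ≤ c := by
      have := hc (6 * a + 2 * r + 1)
      have := (p 1).run4 (6 * a + 2 * r + 1 + c)
      have := (p 0).run0 (6 * a + 2 * r + 1)
      omega
    have b7 : 5 * a + 2 * r + 2 ≤ c := by
      have := hc (a + 1)
      have := (p 0).run0 (a + 1 + c)
      have := h.run2 (a + 1)
      omega
    have b8 : 6 * a + 2 * r + 2 ≤ c := by
      have := hc (2 * a)
      have := (p 0).run4 (2 * a + c)
      have := h.run2 (2 * a)
      omega
    have b9 : 7 * a + 2 * r ≤ c := by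
      have := hc 2
      have := (p 0).run2 (2 + c)
      have := h.run0 2
      omega
    have b10 : 7 * a + 2 * r + 2 ≤ c := by
      have := hc 0
      have := (p 0).run2 (0 + c)
      have := h.run0 0
      omega
    have b11 : 8 * a + 2 * r ≤ c := by
      have := hc (6 * a + 2 * r + 1)
      have := (p 2).run4 (6 * a + 2 * r + 1 + c)
      have := (p 0).run0 (6 * a + 2 * r + 1)
      omega
    have b12 : 8 * a + 3 * r + 2 ≤ c := by
      have := hc 2
      have := (p 0).run6 (2 + c)
      have := h.run0 2
      omega
    have b13 : 8 * a + 3 * r + 4 ≤ c := by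
      have := hc 0
      have := (p 0).run6 (0 + c)
      have := h.run0 0
      omega
    have b14 : 9 * a + 3 * r + 2 ≤ c := by
      have := hc (2 * a)
      have := (p 1).run4 (2 * a + c)
      have := h.run2 (2 * a)
      omega
    omega
  · have b1 : a + 3 ≤ c := by
      have := hc (a - 1)
      have := h.run2 (a - 1 + c)
      have := h.run0 (a - 1)
      omega
    have b2 : 2 * a + 1 ≤ c := by
      have := hc 0
      have := h.run2 (0 + c)
      have := h.run0 0
      omega
    have b3 : 3 * a + 1 ≤ c := by
      have := hc (a + r + 1)
      have := h.run8 (a + r + 1 + c)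
      have := h.run2 (a + r + 1)
      omega
    have b4 : 3 * a + r + 1 ≤ c := by
      have := hc 0
      have := h.run6 (0 + c)
      have := h.run0 0
      omega
    have b5 : 4 * a + r + 1 ≤ c := by
      have := hc (4 * a + r)
      have := (p 0).run4 (4 * a + r + c)
      have := h.run8 (4 * a + r)
      omega
    have b6 : 5 * a + r - 1 ≤ c := by
      have := hc 2
      have := h.run10 (2 + c)
      have := h.run0 2
      omega
    have b7 : 5 * a + r + 1 ≤ c := by
      have := hc 0
      have := h.run10 (0 + c)
      have := h.run0 0
      omega
    have b8 : 6 * a + r - 1 ≤ c := by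
      have := hc (a + r + 3)
      have := (p 0).run2 (a + r + 3 + c)
      have := h.run2 (a + r + 3)
      omega
    have b9 : 6 * a + 2 * r + 1 ≤ c := by
      have := hc 2
      have := (p 0).run0 (2 + c)
      have := h.run0 2
      omega
    have b10 : 6 * a + 2 * r + 3 ≤ c := by
      have := hc 0
      have := (p 0).run0 (0 + c)
      have := h.run0 0
      omega
    have b11 : 7 * a + 2 * r + 1 ≤ c := by
      have := hc (4 * a + r)
      have := (p 1).run4 (4 * a + r + c)
      have := h.run8 (4 * a + r)
      omega
    have b12 : 8 * a + 2 * r - 1 ≤ c := by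
      have := hc 2
      have := (p 0).run4 (2 + c)
      have := h.run0 2
      omega
    have b13 : 8 * a + 2 * r + 1 ≤ c := by
      have := hc 0
      have := (p 0).run4 (0 + c)
      have := h.run0 0
      omega
    have b14 : 9 * a + 2 * r - 1 ≤ c := by
      have := hc (a + r + 3)
      have := (p 1).run2 (a + r + 3 + c)
      have := h.run2 (a + r + 3)
      omega
    have b15 : 9 * a + 3 * r + 1 ≤ c := by
      have := hc 2
      have := (p 1).run0 (2 + c)
      have := h.run0 2
      omega
    omega

theorem PreperiodRuns.eq_of_add_ne_of_eq_two (h : PreperiodRuns G a r 1)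
    (p : ∀ k, PeriodRuns G a r (6 * a + r + 1 + k * (3 * a + r)))
    (hr : r = 2) (ha : r + 4 ≤ a) (ha2 : a % 2 = 0)
    {c : ℕ} (hc1 : 1 ≤ c) (hcN : c < 6 * a + r + 1 + (3 * a + r)) (hc : ∀ n, G (n + c) ≠ G n) :
    c = 1 ∨ c = a ∨ c = 2 * a + 2 := by
  by_contra! hne
  rcases Nat.mod_two_eq_zero_or_one c with hpar | hpar
  · have b1 : a ≤ c := by
      have := hc 0
      have := h.run0 (0 + c)
      have := h.run0 0
      omega
    have b2 : 2 * a + r - 2 ≤ c := by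
      have := hc (4 * a + 4)
      have := h.run13 (4 * a + 4 + c)
      have := h.run9 (4 * a + 4)
      omega
    have b3 : 2 * a + r ≤ c := by
      have := hc (a + 1)
      have := h.run6 (a + 1 + c)
      have := h.run2 (a + 1)
      omega
    have b4 : 3 * a + r - 2 ≤ c := by
      have := hc (3 * a + 3)
      have := h.run13 (3 * a + 3 + c)
      have := h.run7 (3 * a + 3)
      omega
    have b5 : 4 * a + r - 2 ≤ c := by
      have := hc 4
      have := h.run8 (4 + c)
      have := h.run0 4
      omega
    have b6 : 4 * a + r + 2 ≤ c := by
      have := hc 0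
      have := h.run8 (0 + c)
      have := h.run0 0
      omega
    have b7 : 5 * a + 3 * r - 4 ≤ c := by
      have := hc (6 * a + 5)
      have := (p 1).run4 (6 * a + 5 + c)
      have := (p 0).run0 (6 * a + 5)
      omega
    have b8 : 5 * a + 2 * r + 2 ≤ c := by
      have := hc (a + 1)
      have := (p 0).run0 (a + 1 + c)
      have := h.run2 (a + 1)
      omega
    have b9 : 5 * a + 2 * r + 4 ≤ c := by
      have := hc (3 * a - 1)
      have := (p 0).run5 (3 * a - 1 + c)
      have := h.run5 (3 * a - 1)
      omega
    have b10 : 6 * a + 2 * r + 2 ≤ c := by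
      have := hc (2 * a)
      have := (p 0).run4 (2 * a + c)
      have := h.run2 (2 * a)
      omega
    have b11 : 7 * a + 2 * r ≤ c := by
      have := hc 2
      have := (p 0).run2 (2 + c)
      have := h.run0 2
      omega
    have b12 : 7 * a + 2 * r + 2 ≤ c := by
      have := hc 0
      have := (p 0).run2 (0 + c)
      have := h.run0 0
      omega
    have b13 : 8 * a + 4 * r - 4 ≤ c := by
      have := hc (6 * a + 5)
      have := (p 2).run4 (6 * a + 5 + c)
      have := (p 0).run0 (6 * a + 5)
      omega
    have b14 : 8 * a + 3 * r + 2 ≤ c := by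
      have := hc 2
      have := (p 0).run6 (2 + c)
      have := h.run0 2
      omega
    have b15 : 8 * a + 3 * r + 4 ≤ c := by
      have := hc 0
      have := (p 0).run6 (0 + c)
      have := h.run0 0
      omega
    have b16 : 9 * a + 3 * r + 2 ≤ c := by
      have := hc (2 * a)
      have := (p 1).run4 (2 * a + c)
      have := h.run2 (2 * a)
      omega
    omega
  · have b1 : a + 3 ≤ c := by
      have := hc (a - 1)
      have := h.run2 (a - 1 + c)
      have := h.run0 (a - 1)
      omega
    have b2 : 2 * a + 1 ≤ c := by
      have := hc 0
      have := h.run2 (0 + c)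
      have := h.run0 0
      omega
    have b3 : 3 * a + r - 1 ≤ c := by
      have := hc (a + 3)
      have := h.run8 (a + 3 + c)
      have := h.run2 (a + 3)
      omega
    have b4 : 4 * a + r - 3 ≤ c := by
      have := hc (2 * a + 5)
      have := h.run13 (2 * a + 5 + c)
      have := h.run5 (2 * a + 5)
      omega
    have b5 : 5 * a + 2 * r - 7 ≤ c := by
      have := hc (3 * a + 8)
      have := (p 0).run4 (3 * a + 8 + c)
      have := h.run8 (3 * a + 8)
      omega
    have b6 : 5 * a + r - 1 ≤ c := by
      have := hc 2
      have := h.run10 (2 + c)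
      have := h.run0 2
      omega
    have b7 : 5 * a + r + 1 ≤ c := by
      have := hc 0
      have := h.run10 (0 + c)
      have := h.run0 0
      omega
    have b8 : 6 * a + 2 * r - 3 ≤ c := by
      have := hc (a + 5)
      have := (p 0).run2 (a + 5 + c)
      have := h.run2 (a + 5)
      omega
    have b9 : 6 * a + 2 * r + 1 ≤ c := by
      have := hc 2
      have := (p 0).run0 (2 + c)
      have := h.run0 2
      omega
    have b10 : 7 * a + 2 * r - 3 ≤ c := by
      have := hc (2 * a + 5)
      have := (p 0).run7 (2 * a + 5 + c)
      have := h.run5 (2 * a + 5)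
      omega
    have b11 : 8 * a + 3 * r - 7 ≤ c := by
      have := hc (3 * a + 8)
      have := (p 1).run4 (3 * a + 8 + c)
      have := h.run8 (3 * a + 8)
      omega
    have b12 : 8 * a + 2 * r - 1 ≤ c := by
      have := hc 2
      have := (p 0).run4 (2 + c)
      have := h.run0 2
      omega
    have b13 : 8 * a + 2 * r + 1 ≤ c := by
      have := hc 0
      have := (p 0).run4 (0 + c)
      have := h.run0 0
      omega
    have b14 : 9 * a + 3 * r - 3 ≤ c := by
      have := hc (a + 5)
      have := (p 1).run2 (a + 5 + c)
      have := h.run2 (a + 5)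
      omega
    have b15 : 9 * a + 3 * r + 1 ≤ c := by
      have := hc 2
      have := (p 1).run0 (2 + c)
      have := h.run0 2
      omega
    omega

theorem IsGrundy.add_mul_period_eq (hG : IsGrundy {1, a, 2 * a + r} G) (hr : 2 ≤ r)
    (hr2 : r % 2 = 0) (ha : r + 4 ≤ a) (ha2 : a % 2 = 0) (h : PreperiodRuns G a r t) {n : ℕ}
    (hn : 6 * a + r + 1 ≤ n) (k : ℕ) : G (n + k * (3 * a + r)) = G n := by
  induction k with
  | zero => simp
  | succ k ih =>
    rw [Nat.succ_mul, ← add_assoc, hG.add_period_eq hr hr2 ha ha2 h (by omega), ih]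

/-- If the safe additions below the end of the first period satisfy `p`, and `p` holds only below
the end of the preperiod, then every safe addition satisfies `p`. -/
theorem IsGrundy.of_add_ne (hG : IsGrundy {1, a, 2 * a + r} G) (hr : 2 ≤ r)
    (hr2 : r % 2 = 0) (ha : r + 4 ≤ a) (ha2 : a % 2 = 0) (h : PreperiodRuns G a r t)
    {p : ℕ → Prop} (hp : ∀ c, p c → c < 6 * a + r + 1)
    (hlt : ∀ c, 1 ≤ c → c < 6 * a + r + 1 + (3 * a + r) → (∀ n, G (n + c) ≠ G n) → p c)
    {c : ℕ} (hc1 : 1 ≤ c) (hc : ∀ n, G (n + c) ≠ G n) : p c := by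
  rcases lt_or_ge c (6 * a + r + 1 + (3 * a + r)) with hcN | hcN
  · exact hlt c hc1 hcN hc
  · obtain ⟨d, rfl⟩ := Nat.exists_eq_add_of_le (show 6 * a + r + 1 ≤ c by omega)
    have hd := Nat.mod_lt d (show 0 < 3 * a + r by omega)
    have := hp _ <| hlt (6 * a + r + 1 + d % (3 * a + r)) (by omega) (by omega) fun n => by
      rw [← hG.add_mul_period_eq hr hr2 ha ha2 h (by omega) (d / (3 * a + r)), add_assoc,
        add_assoc (6 * a + r + 1), Nat.mod_add_div']
      exact hc n
    omega

theorem IsGrundy.add_two_mul_add_two_ne (hG : IsGrundy {1, a, 2 * a + r} G) (hr : 4 ≤ r)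
    (hr2 : r % 2 = 0) (ha : r + 4 ≤ a) (ha2 : a % 2 = 0) (h : PreperiodRuns G a r 0) (n : ℕ) :
    G (n + (2 * a + r + 2)) ≠ G n := by
  induction n using Nat.strong_induction_on with
  | _ n ih =>
    rcases lt_or_ge n (6 * a + r + 1 + (3 * a + r)) with hn | hn
    · exact h.add_two_mul_add_two_ne
        (hG.periodRuns_add_mul (by omega) hr2 ha ha2 h) hr hr2 ha ha2 hn
    · obtain ⟨m, rfl⟩ := Nat.exists_eq_add_of_le' (show 3 * a + r ≤ n by omega)
      rw [add_right_comm, hG.add_period_eq (by omega) hr2 ha ha2 h (by omega),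
        hG.add_period_eq (by omega) hr2 ha ha2 h (by omega)]
      exact ih m (by omega)

theorem IsGrundy.add_period_add_one_ne (hG : IsGrundy {1, a, 2 * a + r} G) (hr : 4 ≤ r)
    (hr2 : r % 2 = 0) (ha : r + 4 ≤ a) (ha2 : a % 2 = 0) (h : PreperiodRuns G a r 0) (n : ℕ) :
    G (n + (3 * a + r + 1)) ≠ G n := by
  rcases lt_or_ge n (6 * a + r + 1) with hn | hn
  · exact h.add_period_add_one_ne
      (hG.periodRuns_add_mul (by omega) hr2 ha ha2 h) hr hr2 ha ha2 hn
  · rw [show n + (3 * a + r + 1) = n + 1 + (3 * a + r) by ring,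
      hG.add_period_eq (by omega) hr2 ha ha2 h (by omega)]
    exact hG.add_ne (by simp) n

theorem IsGrundy.add_period_add_two_mul_add_two_ne (hG : IsGrundy {1, a, 2 * a + r} G)
    (hr : 4 ≤ r) (hr2 : r % 2 = 0) (ha : r + 4 ≤ a) (ha2 : a % 2 = 0)
    (h : PreperiodRuns G a r 0) (n : ℕ) : G (n + (5 * a + 2 * r + 2)) ≠ G n := by
  rcases lt_or_ge n (4 * a) with hn | hn
  · exact h.add_period_add_two_mul_add_two_ne
      (hG.periodRuns_add_mul (by omega) hr2 ha ha2 h) hr hr2 ha ha2 hn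
  · rw [show n + (5 * a + 2 * r + 2) = n + (2 * a + r + 2) + (3 * a + r) by ring,
      hG.add_period_eq (by omega) hr2 ha ha2 h (by omega)]
    exact hG.add_two_mul_add_two_ne hr hr2 ha ha2 h n

theorem stmt_9 (a r : ℕ) (hr : 2 ≤ r) (hreven : Even r) (ha : r + 4 ≤ a)
    (haeven : Even a) (G : ℕ → ℕ) (hG : IsGrundy {1, a, 2 * a + r} G) :
    (∃ N : ℕ, (∀ n, N ≤ n → G (n + (3 * a + r)) = G n) ∧
      ∀ i < 3 * a + r,
        (i ≤ r + 1 → G (N + i) = i % 2) ∧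
        (i = r + 2 → G (N + i) = 2) ∧
        (r + 3 ≤ i → i ≤ a + r → G (N + i) = (i - r - 3) % 2) ∧
        (i = a + r + 1 → G (N + i) = 2) ∧
        (a + r + 2 ≤ i → i ≤ 2 * a + r - 1 → G (N + i) = (i - a - r - 2) % 2) ∧
        (i = 2 * a + r → G (N + i) = 2) ∧
        (2 * a + r + 1 ≤ i → i ≤ 2 * a + 2 * r + 2 →
          G (N + i) = (i - 2 * a - r - 1) % 2) ∧
        (2 * a + 2 * r + 3 ≤ i → i ≤ 3 * a + r - 2 →
          G (N + i) = 2 + (i - 2 * a - 2 * r - 3) % 2) ∧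
        (i = 3 * a + r - 1 → G (N + i) = 2)) ∧
    ((r = 2 → ∀ c, 1 ≤ c →
      ((∀ n, G (n + c) ≠ G n) ↔ (c = 1 ∨ c = a ∨ c = 2 * a + 2))) ∧
     (4 ≤ r → ∀ c, 1 ≤ c →
      ((∀ n, G (n + c) ≠ G n) ↔
        (c = 1 ∨ c = a ∨ c = 2 * a + r ∨ c = 2 * a + r + 2 ∨
          c = 3 * a + r + 1 ∨ c = 5 * a + 2 * r + 2)))) := by
  have hr2 : r % 2 = 0 := Nat.even_iff.mp hreven
  have ha2 : a % 2 = 0 := Nat.even_iff.mp haeven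
  refine ⟨?_, fun h2 c hc1 => ⟨fun hc => ?_, ?_⟩, fun h4 c hc1 => ⟨fun hc => ?_, ?_⟩⟩
  · obtain ⟨t, ht⟩ : ∃ t, r = 2 ∧ t = 1 ∨ 4 ≤ r ∧ t = 0 := by
      rcases eq_or_ne r 2 with h2 | h2
      · exact ⟨1, by omega⟩
      · exact ⟨0, by omega⟩
    have h := hG.preperiodRuns hr hr2 ha ha2 ht
    refine ⟨6 * a + r + 1, fun n hn => hG.add_period_eq hr hr2 ha ha2 h hn, fun i hi => ?_⟩
    have p := hG.periodRuns_preperiod hr hr2 ha ha2 h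
    refine ⟨fun h1 => ?_, fun h1 => ?_, fun h1 h2 => ?_, fun h1 => ?_, fun h1 h2 => ?_,
      fun h1 => ?_, fun h1 h2 => ?_, fun h1 h2 => ?_, fun h1 => ?_⟩
    · rw [p.run0 _ (by omega) (by omega)]
      omega
    · exact p.run1 _ (by omega)
    · rw [p.run2 _ (by omega) (by omega)]
      omega
    · exact p.run3 _ (by omega)
    · rw [p.run4 _ (by omega) (by omega)]
      omega
    · exact p.run5 _ (by omega)
    · rw [p.run6 _ (by omega) (by omega)]
      omega
    · rw [p.run7 _ (by omega) (by omega)]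
      omega
    · rw [p.run7 _ (by omega) (by omega)]
      omega
  · have h := hG.preperiodRuns hr hr2 ha ha2 (.inl ⟨h2, rfl⟩)
    exact hG.of_add_ne (p := fun c => c = 1 ∨ c = a ∨ c = 2 * a + 2) hr hr2 ha ha2 h
      (fun c hp => by omega)
      (fun c => h.eq_of_add_ne_of_eq_two (hG.periodRuns_add_mul hr hr2 ha ha2 h) h2 ha ha2) hc1 hc
  · subst h2
    rintro (rfl | rfl | rfl) n <;> exact hG.add_ne (by simp) n
  · have h := hG.preperiodRuns hr hr2 ha ha2 (.inr ⟨h4, rfl⟩)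
    exact hG.of_add_ne (p := fun c => c = 1 ∨ c = a ∨ c = 2 * a + r ∨ c = 2 * a + r + 2 ∨
        c = 3 * a + r + 1 ∨ c = 5 * a + 2 * r + 2) hr hr2 ha ha2 h (fun c hp => by omega)
      (fun c => h.eq_of_add_ne (hG.periodRuns_add_mul hr hr2 ha ha2 h) h4 hr2 ha ha2) hc1 hc
  · have h := hG.preperiodRuns hr hr2 ha ha2 (.inr ⟨h4, rfl⟩)
    rintro (rfl | rfl | rfl | rfl | rfl | rfl)
    · exact hG.add_ne (by simp)
    · exact hG.add_ne (by simp)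
    · exact hG.add_ne (by simp)
    · exact hG.add_two_mul_add_two_ne h4 hr2 ha ha2 h
    · exact hG.add_period_add_one_ne h4 hr2 ha ha2 h
    · exact hG.add_period_add_two_mul_add_two_ne h4 hr2 ha ha2 h
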